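/- arXiv:1807.10976 — 2 statements merged into one kernel-verified Lean document; each statement's English description precedes it below -/
import Mathlib

section
/- For every finite metric space A there exists a finite metric space B and an isometric embedding e : A → B such that for every partial isometry φ of A (a distance-preserving bijection between two subsets of A) there exists a bijective self-isometry Φ of B with Φ(e(x)) = e(φ(x)) for every x in the domain of φ. (Extension property for partial isometries of the class of all finite metric spaces.) -/
universe u

/-- `WeightedWalk w k l u v` says that there is a walk from `u` to `v` with `k` steps
whose weights add up to `l`. -/
inductive WeightedWalk {V : Type*} (w : V → V → ℝ) : ℕ → ℝ → V → V → Prop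
  | nil (u : V) : WeightedWalk w 0 0 u u
  | snoc {k : ℕ} {l : ℝ} {u v : V} (z : V) :
      WeightedWalk w k l u v → WeightedWalk w (k + 1) (l + w v z) u z

/-- Pairs of weight less than `D` are edges; an edge is never heavier than a walk of `k` steps
between its ends. -/
def ShortcutFree {V : Type*} (D : ℝ) (w : V → V → ℝ) (k : ℕ) : Prop :=
  ∀ l u v, WeightedWalk w k l u v → w u v < D → w u v ≤ l

/-- Symmetric weights, zero on the diagonal and between `δ` and `D` elsewhere. -/
structure IsBoundedWeight {V : Type*} (δ D : ℝ) (w : V → V → ℝ) : Prop where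
  self : ∀ x, w x x = 0
  comm : ∀ x y, w x y = w y x
  le_of_ne : ∀ x y, x ≠ y → δ ≤ w x y
  le : ∀ x y, w x y ≤ D

/-- A weighted graph containing `A` all of whose partial isometries extend to weight-preserving
permutations. -/
structure ExtendsPartialIsometries {V A : Type*} [MetricSpace A] (δ D : ℝ) (w : V → V → ℝ)
    (e : A → V) : Prop extends IsBoundedWeight δ D w where
  map_dist : ∀ x y, w (e x) (e y) = dist x y
  extend : ∀ (S : Set A) (φ : S → A), (∀ u v : S, dist (φ u) (φ v) = dist (u : A) (v : A)) →
    ∃ θ : Equiv.Perm V, (∀ x y, w (θ x) (θ y) = w x y) ∧ ∀ u : S, θ (e u) = e (φ u)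

namespace WeightedWalk

variable {V W : Type*} {w : V → V → ℝ} {k m : ℕ} {l l' : ℝ} {u v z : V}

theorem single (w : V → V → ℝ) (u v : V) : WeightedWalk w 1 (w u v) u v := by
  simpa using (nil (w := w) u).snoc v

theorem trans (h : WeightedWalk w k l u v) (h' : WeightedWalk w m l' v z) :
    WeightedWalk w (k + m) (l + l') u z := by
  induction h' with
  | nil => simpa using h
  | snoc z _ ih => simpa [add_assoc] using (ih h).snoc z

theorem symm (hw : ∀ x y, w x y = w y x) (h : WeightedWalk w k l u v) :
    WeightedWalk w k l v u := by
  induction h with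
  | nil => exact nil _
  | @snoc k l u v z _ ih =>
    have := (single w z v).trans ih
    rwa [add_comm, hw z v, add_comm _ l] at this

theorem exists_map {w' : W → W → ℝ} (f : V → W) (hf : ∀ x y, w' (f x) (f y) ≤ w x y)
    (h : WeightedWalk w k l u v) : ∃ l' ≤ l, WeightedWalk w' k l' (f u) (f v) := by
  induction h with
  | nil u => exact ⟨0, le_rfl, nil _⟩
  | @snoc k l u v z _ ih =>
    obtain ⟨l', hl, h'⟩ := ih
    exact ⟨_, add_le_add hl (hf v z), h'.snoc (f z)⟩

theorem map_perm (θ : Equiv.Perm V) (hθ : ∀ x y, w (θ x) (θ y) = w x y)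
    (h : WeightedWalk w k l u v) : WeightedWalk w k l (θ u) (θ v) := by
  induction h with
  | nil u => exact nil _
  | @snoc k l u v z _ ih => simpa [hθ] using ih.snoc (θ z)

theorem of_fun (w : V → V → ℝ) (p : ℕ → V) (i m : ℕ) :
    WeightedWalk w m (∑ k ∈ Finset.range m, w (p (i + k)) (p (i + k + 1))) (p i) (p (i + m)) := by
  induction m with
  | zero => exact nil _
  | succ m ih =>
    rw [Finset.sum_range_succ]
    exact ih.snoc _

theorem exists_fun (h : WeightedWalk w k l u v) :
    ∃ p : ℕ → V, p 0 = u ∧ p k = v ∧ ∑ i ∈ Finset.range k, w (p i) (p (i + 1)) = l := by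
  induction h with
  | nil u => exact ⟨fun _ => u, by simp⟩
  | @snoc k l u v z _ ih =>
    obtain ⟨p, h0, hk, hl⟩ := ih
    refine ⟨fun i => if i ≤ k then p i else z, by simpa using h0, by simp, ?_⟩
    rw [Finset.sum_range_succ, ← hl]
    congr 1
    · refine Finset.sum_congr rfl fun i hi => ?_
      have := Finset.mem_range.1 hi
      simp [this.le, Nat.succ_le_of_lt this]
    · simp [hk]

end WeightedWalk

namespace IsBoundedWeight

variable {V : Type*} {δ D : ℝ} {w : V → V → ℝ} {k : ℕ} {l : ℝ} {u v : V}

theorem nonneg (h : IsBoundedWeight δ D w) (hδ : 0 < δ) (x y : V) : 0 ≤ w x y := by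
  by_cases hxy : x = y
  · rw [hxy, h.self]
  · exact hδ.le.trans (h.le_of_ne x y hxy)

/-- Stuttering steps can be dropped from a walk. -/
theorem exists_walk_mul_le (h : IsBoundedWeight δ D w) (hw : WeightedWalk w k l u v) :
    ∃ m ≤ k, m * δ ≤ l ∧ WeightedWalk w m l u v := by
  induction hw with
  | nil u => exact ⟨0, le_rfl, by simp, .nil u⟩
  | @snoc k l u v z _ ih =>
    obtain ⟨m, hm, hl, h'⟩ := ih
    by_cases hvz : v = z
    · subst hvz
      exact ⟨m, by omega, by simpa [h.self] using hl, by simpa [h.self] using h'⟩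
    · refine ⟨m + 1, by omega, ?_, h'.snoc z⟩
      have := h.le_of_ne v z hvz
      push_cast
      linarith

theorem walk_nonneg (h : IsBoundedWeight δ D w) (hδ : 0 < δ) (hw : WeightedWalk w k l u v) :
    0 ≤ l := by
  obtain ⟨m, -, hl, -⟩ := h.exists_walk_mul_le hw
  exact le_trans (by positivity) hl

theorem le_walk_of_ne (h : IsBoundedWeight δ D w) (hδ : 0 < δ) (hw : WeightedWalk w k l u v)
    (huv : u ≠ v) : δ ≤ l := by
  obtain ⟨m, -, hl, h'⟩ := h.exists_walk_mul_le hw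
  cases h' with
  | nil => exact absurd rfl huv
  | @snoc m =>
    have : 0 ≤ m * δ := by positivity
    push_cast at hl
    linarith

theorem shortcutFree_of_forall_lt (h : IsBoundedWeight δ D w) (hδ : 0 < δ) {N : ℕ}
    (hN : D ≤ N * δ) (hfree : ∀ k < N, ShortcutFree D w k) (k : ℕ) : ShortcutFree D w k := by
  intro l u v hw hD
  obtain ⟨m, -, hl, h'⟩ := h.exists_walk_mul_le hw
  by_cases hm : m < N
  · exact hfree m hm l u v h' hD
  · have : (N : ℝ) * δ ≤ m * δ := by
      gcongr
      omega
    linarith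

theorem shortcutFree_of_lt_two (h : IsBoundedWeight δ D w) (hk : k < 2) :
    ShortcutFree D w k := by
  intro l u v hw _
  cases hw with
  | nil => rw [h.self]
  | snoc z hw' =>
    cases hw' with
    | nil => simp
    | snoc => omega

/-- The path metric of a weighted graph. -/
noncomputable abbrev pathMetricSpace (h : IsBoundedWeight δ D w) (hδ : 0 < δ) :
    MetricSpace V where
  dist u v := sInf {l | ∃ k, WeightedWalk w k l u v}
  dist_self u := by
    refine le_antisymm (csInf_le ⟨0, ?_⟩ ⟨0, .nil u⟩) (le_csInf ⟨0, 0, .nil u⟩ ?_)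
    all_goals
      rintro l ⟨k, hl⟩
      exact h.walk_nonneg hδ hl
  dist_comm u v := by
    congr 1
    ext l
    exact exists_congr fun k => ⟨.symm h.comm, .symm h.comm⟩
  dist_triangle u v z := by
    have hne : ∀ u v, {l | ∃ k, WeightedWalk w k l u v}.Nonempty :=
      fun u v => ⟨w u v, 1, .single w u v⟩
    have hbdd : ∀ u v, BddBelow {l | ∃ k, WeightedWalk w k l u v} :=
      fun u v => ⟨0, fun l ⟨k, hl⟩ => h.walk_nonneg hδ hl⟩
    rw [← csInf_add (hne u v) (hbdd u v) (hne v z) (hbdd v z)]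
    refine csInf_le_csInf (hbdd u z) ((hne u v).add (hne v z)) ?_
    rintro _ ⟨l, ⟨k, hl⟩, l', ⟨k', hl'⟩, rfl⟩
    exact ⟨k + k', hl.trans hl'⟩
  eq_of_dist_eq_zero {u v} huv := by
    by_contra hne
    have : δ ≤ sInf {l | ∃ k, WeightedWalk w k l u v} :=
      le_csInf ⟨w u v, 1, .single w u v⟩ fun l ⟨k, hl⟩ => h.le_walk_of_ne hδ hl hne
    exact hδ.not_ge (huv ▸ this)

/-- If the ends of `p i` and `p j` are joined by an edge which is neither a step of the walk `p`
nor joins its ends, then a shortcut of an edge by `p` yields one with fewer steps. -/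
theorem eq_succ_or_of_edge {n : ℕ} (hfree : ∀ k < n, ShortcutFree D w k) {p : ℕ → V}
    (hlt : ∑ k ∈ Finset.range n, w (p k) (p (k + 1)) < w (p 0) (p n)) (hD : w (p 0) (p n) < D)
    {i j : ℕ} (hij : i < j) (hj : j ≤ n) (hedge : w (p i) (p j) < D) :
    j = i + 1 ∨ i = 0 ∧ j = n := by
  by_contra! hcon
  obtain ⟨b, rfl⟩ := Nat.exists_eq_add_of_le hij.le
  obtain ⟨c, rfl⟩ := Nat.exists_eq_add_of_le hj
  have h₁ := WeightedWalk.of_fun w p 0 i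
  have h₂ := WeightedWalk.of_fun w p i b
  have h₃ := WeightedWalk.of_fun w p (i + b) c
  rw [Finset.sum_range_add, Finset.sum_range_add] at hlt
  simp only [zero_add] at h₁
  have := hfree b (by omega) _ _ _ h₂ hedge
  have := hfree _ (by omega) _ _ _ ((h₁.trans (.single w _ _)).trans h₃) hD
  linarith

end IsBoundedWeight

/-- Finitely many numbers can be labelled by the elements of a finite abelian group. -/
theorem Finset.Nonempty.exists_group_labelling {S : Finset ℝ} (hS : S.Nonempty) :
    ∃ (G : Type) (_ : AddCommGroup G) (_ : Finite G) (val : G → ℝ) (label : ℝ → G),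
      (∀ g, val g ∈ S) ∧ ∀ s ∈ S, val (label s) = s := by
  classical
  have : NeZero S.card := ⟨hS.card_pos.ne'⟩
  let r : S ≃ ZMod S.card := S.equivFin.trans (ZMod.finEquiv _).toEquiv
  refine ⟨ZMod S.card, inferInstance, inferInstance, fun g => r.symm g,
    fun s => if hs : s ∈ S then r ⟨s, hs⟩ else 0, fun g => (r.symm g).2, fun s hs => ?_⟩
  simp [hs]

/-- The permutation of `V × (X → G)` which applies `θ` and `E` to `V` and `X` and translates the
fibre over `v` by `c v`. -/
def Equiv.Perm.twist {V X G : Type*} [AddGroup G] (θ : Equiv.Perm V) (E : Equiv.Perm X)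
    (c : V → X → G) : Equiv.Perm (V × (X → G)) where
  toFun p := (θ p.1, fun x => p.2 (E.symm x) + c p.1 (E.symm x))
  invFun p := (θ.symm p.1, fun x => p.2 (E x) - c (θ.symm p.1) x)
  left_inv p := by simp
  right_inv p := by simp

/-- Every finite metric space embeds in a finite weighted graph extending its partial
isometries. -/
theorem exists_extendsPartialIsometries (A : Type u) [MetricSpace A] [Finite A] {δ D : ℝ}
    (hδD : δ ≤ D) (hδ : ∀ x y : A, x ≠ y → δ ≤ dist x y) (hD : ∀ x y : A, dist x y ≤ D) :
    ∃ (V : Type u) (_ : Finite V) (w : V → V → ℝ) (e : A → V),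
      ExtendsPartialIsometries δ D w e := by
  classical
  have := Fintype.ofFinite A
  obtain ⟨G, _, _, val, label, hval, hlabel⟩ := Finset.Nonempty.exists_group_labelling
    (Finset.insert_nonempty D ((Finset.univ : Finset A).offDiag.image fun p => dist p.1 p.2))
  have hval' : ∀ g, δ ≤ val g ∧ val g ≤ D := by
    intro g
    rcases Finset.mem_insert.1 (hval g) with h | h
    · simp [h, hδD]
    · obtain ⟨⟨x, y⟩, hxy, h⟩ := Finset.mem_image.1 h
      rw [← h]
      exact ⟨hδ x y (by simpa using hxy), hD x y⟩
  have hlabel' : ∀ x y : A, x ≠ y → val (label (dist x y)) = dist x y := by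
    intro x y hxy
    exact hlabel _ (Finset.mem_insert_of_mem
      (Finset.mem_image.2 ⟨(x, y), by simpa using hxy, rfl⟩))
  let r := Fintype.equivFin A
  let a : A → A → G := fun x y => if r x < r y then label (dist x y) else 0
  have ha : ∀ x y, x ≠ y → a x y + a y x = label (dist x y) := by
    intro x y hxy
    rcases lt_or_gt_of_ne (r.injective.ne hxy) with h | h <;> simp [a, h, h.not_gt, dist_comm]
  let w : A × (A → G) → A × (A → G) → ℝ := fun p q =>
    if p = q then 0 else if p.1 = q.1 then D else val (p.2 q.1 + q.2 p.1)
  refine ⟨A × (A → G), inferInstance, w, fun x => (x, a x), ⟨?_, ?_, ?_, ?_⟩, ?_, ?_⟩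
  · intro p
    simp [w]
  · intro p q
    simp only [w, eq_comm (a := p), eq_comm (a := p.1), add_comm (p.2 q.1)]
  · intro p q hpq
    simp only [w, hpq, if_false]
    split_ifs
    · exact hδD
    · exact (hval' _).1
  · intro p q
    have : 0 ≤ D := (hD p.1 p.1).trans' dist_nonneg
    simp only [w]
    split_ifs
    · exact this
    · exact le_rfl
    · exact (hval' _).2
  · intro x y
    by_cases hxy : x = y
    · simp [w, hxy]
    · simp [w, hxy, ha, hlabel']
  · intro S φ hφ
    have hinj : Function.Injective φ := fun u v huv => by
      rw [← Subtype.coe_inj, ← dist_eq_zero, ← hφ, huv, dist_self]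
    obtain ⟨σ, hσ⟩ := Equiv.Perm.exists_extending_pair ((↑) : S → A) φ
      Subtype.val_injective hinj
    let f : A → A → G := fun v u => a (σ v) (σ u) - a v u
    have hf : ∀ v ∈ S, ∀ u ∈ S, v ≠ u → f v u + f u v = 0 := by
      intro v hv u hu hvu
      have h₁ := ha v u hvu
      have h₂ := ha (σ v) (σ u) (σ.injective.ne hvu)
      have h₃ : dist (σ v) (σ u) = dist v u := by
        rw [hσ ⟨v, hv⟩, hσ ⟨u, hu⟩, hφ]
      rw [h₃, ← h₁] at h₂
      simp only [f]
      rw [sub_add_sub_comm, h₂, sub_self]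
    let c : A → A → G := fun v u => if v ∈ S then f v u else if u ∈ S then -f u v else 0
    have hc : ∀ v u, v ≠ u → c v u + c u v = 0 := by
      intro v u hvu
      by_cases hv : v ∈ S <;> by_cases hu : u ∈ S <;> simp [c, hv, hu]
      exact hf v hv u hu hvu
    refine ⟨σ.twist σ c, ?_, ?_⟩
    · intro p q
      have h₁ : σ.twist σ c p = σ.twist σ c q ↔ p = q := (σ.twist σ c).injective.eq_iff
      simp only [w, h₁]
      by_cases h : p.1 = q.1
      · simp [h, Equiv.Perm.twist]
      · have : p.2 q.1 + c p.1 q.1 + (q.2 p.1 + c q.1 p.1) = p.2 q.1 + q.2 p.1 := by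
          rw [add_add_add_comm, hc _ _ h, add_zero]
        simp [h, Equiv.Perm.twist, this]
    · intro u
      ext x
      · simp [Equiv.Perm.twist, hσ]
      · simp [Equiv.Perm.twist, c, f, hσ]

theorem exists_dist_bounds (A : Type*) [MetricSpace A] [Finite A] :
    ∃ δ D : ℝ, 0 < δ ∧ δ ≤ D ∧ (∀ x y : A, x ≠ y → δ ≤ dist x y) ∧ ∀ x y : A, dist x y < D := by
  obtain ⟨a, ha⟩ := (Set.finite_range fun p : A × A => dist p.1 p.2).bddAbove
  obtain ⟨b, hb⟩ := (Set.finite_range fun p : A × A => (dist p.1 p.2)⁻¹).bddAbove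
  refine ⟨(max b 1)⁻¹, max a 1 + 1, by positivity, ?_, ?_, ?_⟩
  · have : (max b 1)⁻¹ ≤ 1 := inv_le_one_of_one_le₀ (le_max_right _ _)
    linarith [le_max_right a 1]
  · intro x y hxy
    have := hb ⟨(x, y), rfl⟩
    exact inv_le_of_inv_le₀ (dist_pos.2 hxy) (this.trans (le_max_left _ _))
  · intro x y
    have : dist x y ≤ a := ha ⟨(x, y), rfl⟩
    linarith [le_max_left a 1]

/-- An edge from `p 0` to `p n` which is heavier than the walk `p 0, …, p n`. -/
def IsShortcut {V : Type*} (D : ℝ) (w : V → V → ℝ) (n : ℕ) (p : ℕ → V) : Prop :=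
  ∑ k ∈ Finset.range n, w (p k) (p (k + 1)) < w (p 0) (p n) ∧ w (p 0) (p n) < D

/-- `u` and `v` are consecutive on the walk `p 0, …, p n`. -/
def IsWalkStep {V : Type*} (n : ℕ) (p : ℕ → V) (u v : V) : Prop :=
  ∃ k < n, u = p k ∧ v = p (k + 1) ∨ v = p k ∧ u = p (k + 1)

/-- `u` and `v` are the ends of the walk `p 0, …, p n`. -/
def IsWalkEnds {V : Type*} (n : ℕ) (p : ℕ → V) (u v : V) : Prop :=
  u = p 0 ∧ v = p n ∨ v = p 0 ∧ u = p n

/-- The walk `p 0, …, p n` listed by a tuple. -/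
def tupleWalk {V : Type*} {n : ℕ} (M : Fin (n + 1) → V) (k : ℕ) : V :=
  M (Fin.ofNat (n + 1) k)

theorem tupleWalk_val {V : Type*} {n k : ℕ} (p : ℕ → V) (hk : k ≤ n) :
    tupleWalk (fun i : Fin (n + 1) => p i) k = p k := by
  simp [tupleWalk, Nat.mod_eq_of_lt (Nat.lt_succ_of_le hk)]

theorem IsWalkStep.symm {V : Type*} {n : ℕ} {p : ℕ → V} {u v : V} (h : IsWalkStep n p u v) :
    IsWalkStep n p v u :=
  let ⟨k, hk, h⟩ := h
  ⟨k, hk, h.symm⟩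

theorem IsWalkEnds.symm {V : Type*} {n : ℕ} {p : ℕ → V} {u v : V} (h : IsWalkEnds n p u v) :
    IsWalkEnds n p v u :=
  Or.symm h

section Perm

variable {V : Type*} {D : ℝ} {w : V → V → ℝ} {n : ℕ} (θ : Equiv.Perm V)

theorem isShortcut_comp_perm_iff (hθ : ∀ x y, w (θ x) (θ y) = w x y) (p : ℕ → V) :
    IsShortcut D w n (fun k => θ (p k)) ↔ IsShortcut D w n p := by
  simp [IsShortcut, hθ]

theorem isWalkStep_comp_perm_iff (p : ℕ → V) (u v : V) :
    IsWalkStep n (fun k => θ (p k)) (θ u) (θ v) ↔ IsWalkStep n p u v := by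
  simp [IsWalkStep]

theorem isWalkEnds_comp_perm_iff (p : ℕ → V) (u v : V) :
    IsWalkEnds n (fun k => θ (p k)) (θ u) (θ v) ↔ IsWalkEnds n p u v := by
  simp [IsWalkEnds]

end Perm

namespace IsShortcut

variable {V : Type*} {δ D : ℝ} {w : V → V → ℝ} {n : ℕ} {p : ℕ → V}

theorem step_lt (hp : IsShortcut D w n p) (h : IsBoundedWeight δ D w) (hδ : 0 < δ) {k : ℕ}
    (hk : k < n) : w (p k) (p (k + 1)) < w (p 0) (p n) :=
  (Finset.single_le_sum (f := fun k => w (p k) (p (k + 1))) (fun _ _ => h.nonneg hδ _ _)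
    (Finset.mem_range.2 hk)).trans_lt hp.1

theorem ends_ne (hp : IsShortcut D w n p) (h : IsBoundedWeight δ D w) (hδ : 0 < δ) :
    p 0 ≠ p n := by
  intro h0
  have h₁ := hp.1
  rw [← h0, h.self] at h₁
  exact h₁.not_ge (Finset.sum_nonneg fun _ _ => h.nonneg hδ _ _)

variable {A : Type*} [MetricSpace A] {e : A → V}

theorem eq_succ_or (hp : IsShortcut D w n p) (h : ExtendsPartialIsometries δ D w e)
    (hD : ∀ x y : A, dist x y < D) (hfree : ∀ k < n, ShortcutFree D w k) {i j : ℕ} {a b : A}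
    (ha : e a = p i) (hb : e b = p j) (hij : i < j) (hj : j ≤ n) :
    j = i + 1 ∨ i = 0 ∧ j = n :=
  IsBoundedWeight.eq_succ_or_of_edge hfree hp.1 hp.2 hij hj
    (by rw [← ha, ← hb, h.map_dist]; exact hD a b)

theorem isWalkStep_or_isWalkEnds (hp : IsShortcut D w n p)
    (h : ExtendsPartialIsometries δ D w e) (hD : ∀ x y : A, dist x y < D)
    (hfree : ∀ k < n, ShortcutFree D w k) {i j : ℕ} {a b : A} (ha : e a = p i) (hb : e b = p j)
    (hi : i ≤ n) (hj : j ≤ n) (hab : e a ≠ e b) :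
    IsWalkStep n p (e a) (e b) ∨ IsWalkEnds n p (e a) (e b) := by
  wlog hij : i < j generalizing i j a b
  · have hji : j < i := by
      refine lt_of_le_of_ne (not_lt.1 hij) ?_
      rintro rfl
      exact hab (ha.trans hb.symm)
    exact (this hb ha hj hi hab.symm hji).imp .symm .symm
  rcases hp.eq_succ_or h hD hfree ha hb hij hj with rfl | ⟨rfl, rfl⟩
  · exact .inl ⟨i, hij.trans_le hj, .inl ⟨ha, hb⟩⟩
  · exact .inr (.inl ⟨ha, hb⟩)

theorem false_of_triangle {a b c : A} (h : ExtendsPartialIsometries δ D w e)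
    (hp : IsShortcut D w 2 p) (ha : e a = p 0) (hb : e b = p 1) (hc : e c = p 2) : False := by
  have h₁ := hp.1
  simp only [Finset.sum_range_succ, Finset.sum_range_zero, zero_add, Nat.reduceAdd, ← ha, ← hb,
    ← hc, h.map_dist] at h₁
  linarith [dist_triangle a b c]

/-- The end `p n` of a shortened walk whose start lies in `A` is not the end of a step in `A`. -/
theorem step_eq_last_iff (hp : IsShortcut D w n p) (h : ExtendsPartialIsometries δ D w e)
    (hδ : 0 < δ) (hD : ∀ x y : A, dist x y < D) (hfree : ∀ k < n, ShortcutFree D w k)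
    {a b c : A} (hc : e c = p 0) (hab : IsWalkStep n p (e a) (e b)) :
    e a = p n ↔ e b = p n := by
  have key : ∀ k < n, ∀ a b : A, e a = p k → e b = p (k + 1) → (e a = p n ↔ e b = p n) := by
    intro k hk a b ha hb
    have hne := hp.ends_ne h.toIsBoundedWeight hδ
    have hlt := hp.step_lt h.toIsBoundedWeight hδ hk
    rcases Nat.eq_zero_or_pos k with rfl | hk0
    · refine iff_of_false (by rwa [ha]) fun hbn => ?_
      rw [← hb, hbn] at hlt
      exact lt_irrefl _ hlt
    have hk1 := hp.eq_succ_or h hD hfree hc ha hk0 hk.le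
    obtain rfl : k = 1 := by omega
    have h2 := hp.eq_succ_or h hD hfree hc hb (by omega) hk
    obtain rfl : n = 2 := by omega
    exact (hp.false_of_triangle h hc ha hb).elim
  obtain ⟨k, hk, ⟨ha, hb⟩ | ⟨hb, ha⟩⟩ := hab
  · exact key k hk a b ha hb
  · exact (key k hk b a hb ha).symm

end IsShortcut

/-- The vertex labels `χ` and `ξ` over `u` and `v` allow an edge: they agree at every shortcut
around which `u` and `v` are consecutive and differ at every shortcut with ends `u` and `v`. -/
def LabelsCompatible {V : Type*} (D : ℝ) (w : V → V → ℝ) (n : ℕ)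
    (p q : V × ((Fin (n + 1) → V) → ZMod 2)) : Prop :=
  ∀ M, IsShortcut D w n (tupleWalk M) →
    (IsWalkStep n (tupleWalk M) p.1 q.1 → p.2 M = q.2 M) ∧
    (IsWalkEnds n (tupleWalk M) p.1 q.1 → p.2 M ≠ q.2 M)

theorem LabelsCompatible.symm {V : Type*} {D : ℝ} {w : V → V → ℝ} {n : ℕ}
    {p q : V × ((Fin (n + 1) → V) → ZMod 2)} (h : LabelsCompatible D w n p q) :
    LabelsCompatible D w n q p :=
  fun M hM => ⟨fun hs => ((h M hM).1 hs.symm).symm, fun he => ((h M hM).2 he.symm).symm⟩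

open Classical in
/-- The weights on the double covers of `V` unwrapping all shortcuts of `n` steps. -/
noncomputable def unwrappedWeight {V : Type*} (D : ℝ) (w : V → V → ℝ) (n : ℕ)
    (p q : V × ((Fin (n + 1) → V) → ZMod 2)) : ℝ :=
  if p = q then 0 else if p.1 ≠ q.1 ∧ LabelsCompatible D w n p q then w p.1 q.1 else D

section Unwrapped

variable {V : Type*} {δ D : ℝ} {w : V → V → ℝ} {n : ℕ}

theorem IsBoundedWeight.unwrapped (h : IsBoundedWeight δ D w) (hδ : 0 < δ) (hδD : δ ≤ D) :
    IsBoundedWeight δ D (unwrappedWeight D w n) where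
  self p := by simp [unwrappedWeight]
  comm p q := by
    classical
    exact if_congr eq_comm rfl (if_congr (and_congr ne_comm ⟨.symm, .symm⟩) (h.comm _ _) rfl)
  le_of_ne p q hpq := by
    simp only [unwrappedWeight, hpq, if_false]
    split_ifs with hc
    · exact h.le_of_ne _ _ hc.1
    · exact hδD
  le p q := by
    unfold unwrappedWeight
    split_ifs
    · exact hδ.le.trans hδD
    · exact h.le _ _
    · exact le_rfl

theorem IsBoundedWeight.le_unwrapped (h : IsBoundedWeight δ D w)
    (p q : V × ((Fin (n + 1) → V) → ZMod 2)) : w p.1 q.1 ≤ unwrappedWeight D w n p q := by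
  unfold unwrappedWeight
  split_ifs with hpq
  · rw [hpq, h.self]
  · exact le_rfl
  · exact h.le _ _

theorem unwrapped_lt {p q : V × ((Fin (n + 1) → V) → ZMod 2)}
    (hlt : unwrappedWeight D w n p q < D) (hpq : p ≠ q) :
    LabelsCompatible D w n p q ∧ unwrappedWeight D w n p q = w p.1 q.1 := by
  unfold unwrappedWeight at hlt ⊢
  rw [if_neg hpq] at hlt ⊢
  split_ifs at hlt ⊢ with hc
  · exact ⟨hc.2, rfl⟩
  · exact absurd hlt (lt_irrefl _)

theorem IsBoundedWeight.shortcutFree_unwrapped_of_lt (h : IsBoundedWeight δ D w) (hδ : 0 < δ)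
    (hδD : δ ≤ D) {k : ℕ} (hfree : ShortcutFree D w k) :
    ShortcutFree D (unwrappedWeight D w n) k := by
  intro l p q hl hlt
  by_cases hpq : p = q
  · rw [hpq, (h.unwrapped hδ hδD).self]
    exact (h.unwrapped hδ hδD).walk_nonneg hδ hl
  · obtain ⟨l', hl', hw⟩ := hl.exists_map Prod.fst (h.le_unwrapped)
    have := (unwrapped_lt hlt hpq).2
    rw [this] at hlt ⊢
    exact (hfree l' _ _ hw hlt).trans hl'

theorem IsBoundedWeight.shortcutFree_unwrapped (h : IsBoundedWeight δ D w) (hδ : 0 < δ)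
    (hδD : δ ≤ D) : ShortcutFree D (unwrappedWeight D w n) n := by
  intro l p q hl hlt
  by_contra! hcon
  have h' := h.unwrapped (n := n) hδ hδD
  have hpq : p ≠ q := by
    rintro rfl
    rw [h'.self] at hcon
    exact hcon.not_ge (h'.walk_nonneg hδ hl)
  obtain ⟨hc, hpqw⟩ := unwrapped_lt hlt hpq
  obtain ⟨P, rfl, rfl, rfl⟩ := hl.exists_fun
  have hP : IsShortcut D (unwrappedWeight D w n) n P := ⟨hcon, hlt⟩
  let M : Fin (n + 1) → V := fun i => (P i).1
  have hM : ∀ k ≤ n, tupleWalk M k = (P k).1 := fun k hk => tupleWalk_val (fun k => (P k).1) hk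
  have hMs : IsShortcut D w n (tupleWalk M) := by
    rw [IsShortcut, hM 0 n.zero_le, hM n le_rfl, ← hpqw]
    refine ⟨(Finset.sum_le_sum fun k hk => ?_).trans_lt hcon, hlt⟩
    have hk' := Finset.mem_range.1 hk
    rw [hM k hk'.le, hM (k + 1) hk']
    exact h.le_unwrapped _ _
  have hconst : ∀ k ≤ n, (P 0).2 M = (P k).2 M := by
    intro k
    induction k with
    | zero => simp
    | succ k ih =>
      intro hk
      rw [ih (by omega)]
      by_cases heq : P k = P (k + 1)
      · rw [← heq]
      · have := (unwrapped_lt ((hP.step_lt h' hδ hk).trans hlt) heq).1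
        exact (this M hMs).1 ⟨k, hk, .inl ⟨(hM k (by omega)).symm, (hM _ hk).symm⟩⟩
  exact (hc M hMs).2 (.inl ⟨(hM 0 n.zero_le).symm, (hM n le_rfl).symm⟩) (hconst n le_rfl)

variable {A : Type*} [MetricSpace A] {e : A → V}

open Classical in
/-- The label of the copy of `A` in the unwrapped graph. -/
noncomputable def baseLabel (e : A → V) (n : ℕ) (a : A) (M : Fin (n + 1) → V) : ZMod 2 :=
  if (∃ b, e b = tupleWalk M 0) ∧ e a = tupleWalk M n then 1 else 0

theorem ExtendsPartialIsometries.labelsCompatible (h : ExtendsPartialIsometries δ D w e)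
    (hδ : 0 < δ) (hD : ∀ x y : A, dist x y < D) (hfree : ∀ k < n, ShortcutFree D w k) (a b : A) :
    LabelsCompatible D w n (e a, baseLabel e n a) (e b, baseLabel e n b) := by
  classical
  intro M hM
  refine ⟨fun hs => ?_, fun he => ?_⟩
  · by_cases h0 : ∃ c, e c = tupleWalk M 0
    · obtain ⟨c, hc⟩ := h0
      have := hM.step_eq_last_iff h hδ hD hfree hc hs
      exact if_congr (and_congr_right fun _ => this) rfl rfl
    · simp [baseLabel, h0]
  · have hne := hM.ends_ne h.toIsBoundedWeight hδ
    rcases he with ⟨ha, hb⟩ | ⟨hb, ha⟩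
    all_goals
      dsimp only at ha hb
      rw [← ha, ← hb] at hne
      simp [baseLabel, ← ha, ← hb, hne]

theorem labelsCompatible_twist_iff {θ : Equiv.Perm V} (hθ : ∀ x y, w (θ x) (θ y) = w x y)
    {c : V → (Fin (n + 1) → V) → ZMod 2}
    (hc : ∀ M, IsShortcut D w n (tupleWalk M) → ∀ i ≤ n, ∀ j ≤ n,
      c (tupleWalk M i) M = c (tupleWalk M j) M)
    (p q : V × ((Fin (n + 1) → V) → ZMod 2)) :
    LabelsCompatible D w n (θ.twist ((Equiv.refl _).arrowCongr θ) c p)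
      (θ.twist ((Equiv.refl _).arrowCongr θ) c q) ↔ LabelsCompatible D w n p q := by
  let E : Equiv.Perm (Fin (n + 1) → V) := (Equiv.refl _).arrowCongr θ
  unfold LabelsCompatible
  rw [E.surjective.forall]
  refine forall_congr' fun M => ?_
  have hE : tupleWalk (E M) = fun k => θ (tupleWalk M k) := rfl
  rw [hE, isShortcut_comp_perm_iff θ hθ]
  refine imp_congr_right fun hM => ?_
  have h₂ : ∀ r : V × ((Fin (n + 1) → V) → ZMod 2),
      (θ.twist E c r).2 (E M) = r.2 M + c r.1 M := by simp [Equiv.Perm.twist]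
  change (IsWalkStep n _ (θ p.1) (θ q.1) → (θ.twist E c p).2 (E M) = (θ.twist E c q).2 (E M)) ∧
    (IsWalkEnds n _ (θ p.1) (θ q.1) → (θ.twist E c p).2 (E M) ≠ (θ.twist E c q).2 (E M)) ↔ _
  rw [isWalkStep_comp_perm_iff, isWalkEnds_comp_perm_iff, h₂, h₂]
  refine and_congr (imp_congr_right ?_) (imp_congr_right ?_)
  · rintro ⟨k, hk, ⟨hp, hq⟩ | ⟨hq, hp⟩⟩
    all_goals rw [hp, hq, hc M hM k hk.le (k + 1) hk, add_left_inj]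
  · rintro (⟨hp, hq⟩ | ⟨hq, hp⟩)
    all_goals rw [hp, hq, hc M hM 0 n.zero_le n le_rfl, Ne, Ne, add_left_inj]

/-- Translations of the labels realising `φ` which are constant along every shortcut. -/
theorem ExtendsPartialIsometries.exists_translation (h : ExtendsPartialIsometries δ D w e)
    (hδ : 0 < δ) (hD : ∀ x y : A, dist x y < D) (hfree : ∀ k < n, ShortcutFree D w k)
    {S : Set A} {φ : S → A} {θ : Equiv.Perm V} (hθ : ∀ x y, w (θ x) (θ y) = w x y)
    (hθφ : ∀ u : S, θ (e u) = e (φ u)) :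
    ∃ c : V → (Fin (n + 1) → V) → ZMod 2,
      (∀ (u : S) M, baseLabel e n u M + c (e u) M = baseLabel e n (φ u) (fun i => θ (M i))) ∧
      ∀ M, IsShortcut D w n (tupleWalk M) → ∀ i ≤ n, ∀ j ≤ n,
        c (tupleWalk M i) M = c (tupleWalk M j) M := by
  classical
  have hinj : Function.Injective e := fun x y hxy => by
    rw [← dist_eq_zero, ← h.map_dist, hxy, h.self]
  let f : S → (Fin (n + 1) → V) → ZMod 2 := fun u M =>
    baseLabel e n (φ u) (fun i => θ (M i)) - baseLabel e n u M
  have hf : ∀ M, IsShortcut D w n (tupleWalk M) → ∀ u v : S, (∃ i ≤ n, e u = tupleWalk M i) →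
      (∃ j ≤ n, e v = tupleWalk M j) → f u M = f v M := by
    rintro M hM u v ⟨i, hi, hu⟩ ⟨j, hj, hv⟩
    by_cases huv : u = v
    · rw [huv]
    have hM' : IsShortcut D w n (tupleWalk fun i => θ (M i)) :=
      (isShortcut_comp_perm_iff θ hθ _).2 hM
    have h₁ := h.labelsCompatible hδ hD hfree u v M hM
    have h₂ := h.labelsCompatible hδ hD hfree (φ u) (φ v) _ hM'
    dsimp only at h₁ h₂
    simp only [f]
    rcases hM.isWalkStep_or_isWalkEnds h hD hfree hu hv hi hj
      (hinj.ne (Subtype.coe_injective.ne huv)) with hs | he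
    · rw [h₁.1 hs, h₂.1]
      rw [← hθφ, ← hθφ]
      exact (isWalkStep_comp_perm_iff θ _ _ _).2 hs
    · have h₃ := h₁.2 he
      have h₄ := h₂.2 (by
        rw [← hθφ, ← hθφ]
        exact (isWalkEnds_comp_perm_iff θ _ _ _).2 he)
      generalize baseLabel e n _ _ = a₁ at *
      generalize baseLabel e n _ _ = a₂ at *
      generalize baseLabel e n _ _ = a₃ at *
      generalize baseLabel e n _ _ = a₄ at *
      clear * - h₃ h₄
      decide +revert
  let c : V → (Fin (n + 1) → V) → ZMod 2 := fun v M =>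
    if h : ∃ u : S, e u = v then f h.choose M
    else if h : ∃ u : S, ∃ i ≤ n, e u = tupleWalk M i then f h.choose M else 0
  refine ⟨c, fun u M => ?_, fun M hM => ?_⟩
  · have hu : ∃ u' : S, e u' = e u := ⟨u, rfl⟩
    have : hu.choose = u := Subtype.coe_injective (hinj hu.choose_spec)
    simp only [c, dif_pos hu, this, f]
    exact add_sub_cancel _ _
  · by_cases hS : ∃ u : S, ∃ i ≤ n, e u = tupleWalk M i
    · have key : ∀ i ≤ n, c (tupleWalk M i) M = f hS.choose M := by
        intro i hi
        by_cases hv : ∃ u : S, e u = tupleWalk M i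
        · simp only [c, dif_pos hv]
          exact hf M hM _ _ ⟨i, hi, hv.choose_spec⟩ hS.choose_spec
        · simp only [c, dif_neg hv, dif_pos hS]
      intro i hi j hj
      rw [key i hi, key j hj]
    · have key : ∀ i ≤ n, c (tupleWalk M i) M = 0 := by
        intro i hi
        have hv : ¬∃ u : S, e u = tupleWalk M i := fun ⟨u, hu⟩ => hS ⟨u, i, hi, hu⟩
        simp only [c, dif_neg hv, dif_neg hS]
      intro i hi j hj
      rw [key i hi, key j hj]

theorem ExtendsPartialIsometries.unwrapped (h : ExtendsPartialIsometries δ D w e)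
    (hδ : 0 < δ) (hδD : δ ≤ D) (hD : ∀ x y : A, dist x y < D)
    (hfree : ∀ k < n, ShortcutFree D w k) :
    ExtendsPartialIsometries δ D (unwrappedWeight D w n) fun a => (e a, baseLabel e n a) where
  toIsBoundedWeight := h.toIsBoundedWeight.unwrapped hδ hδD
  map_dist x y := by
    by_cases hxy : x = y
    · simp [unwrappedWeight, hxy]
    · have hne : e x ≠ e y := fun he => hxy <| by
        rw [← dist_eq_zero, ← h.map_dist, he, h.self]
      simp [unwrappedWeight, hne, h.labelsCompatible hδ hD hfree, h.map_dist]
  extend S φ hφ := by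
    classical
    obtain ⟨θ, hθ, hθφ⟩ := h.extend S φ hφ
    obtain ⟨c, hcS, hc⟩ := h.exists_translation hδ hD hfree hθ hθφ
    refine ⟨θ.twist ((Equiv.refl _).arrowCongr θ) c, fun p q => ?_, fun u => ?_⟩
    · exact if_congr (Equiv.injective _).eq_iff rfl (if_congr
        (and_congr θ.injective.ne_iff (labelsCompatible_twist_iff hθ hc p q)) (hθ _ _) rfl)
    · ext M
      · exact hθφ u
      · obtain ⟨M, rfl⟩ := ((Equiv.refl (Fin (n + 1))).arrowCongr θ).surjective M
        simp only [Equiv.Perm.twist, Equiv.coe_fn_mk, Equiv.symm_apply_apply]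
        exact hcS u M

end Unwrapped

/-- Every finite metric space embeds in a finite weighted graph which extends its partial
isometries and in which no walk of fewer than `n` steps is shorter than an edge. -/
theorem exists_extendsPartialIsometries_shortcutFree (A : Type u) [MetricSpace A] [Finite A]
    {δ D : ℝ} (hδ₀ : 0 < δ) (hδD : δ ≤ D) (hδ : ∀ x y : A, x ≠ y → δ ≤ dist x y)
    (hD : ∀ x y : A, dist x y < D) (n : ℕ) :
    ∃ (V : Type u) (_ : Finite V) (w : V → V → ℝ) (e : A → V),
      ExtendsPartialIsometries δ D w e ∧ ∀ k < n, ShortcutFree D w k := by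
  induction n with
  | zero =>
    obtain ⟨V, hV, w, e, h⟩ := exists_extendsPartialIsometries A hδD hδ fun x y => (hD x y).le
    exact ⟨V, hV, w, e, h, by simp⟩
  | succ n ih =>
    obtain ⟨V, _, w, e, h, hfree⟩ := ih
    refine ⟨V × ((Fin (n + 1) → V) → ZMod 2), inferInstance, _, _,
      h.unwrapped hδ₀ hδD hD hfree, fun k hk => ?_⟩
    rcases Nat.lt_succ_iff_lt_or_eq.1 hk with hk | rfl
    · exact h.shortcutFree_unwrapped_of_lt hδ₀ hδD (hfree k hk)
    · exact h.shortcutFree_unwrapped hδ₀ hδD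

/-- **Extension property for partial isometries of finite metric spaces**
(Solecki, Vershik). For every finite metric space `A` there is a finite metric
space `B` and an isometric embedding `e : A → B` such that every partial isometry
of `A` (a distance-preserving bijection `φ` between two subsets `S`, `T` of `A`)
extends to a bijective self-isometry `Φ` of `B`, in the sense that
`Φ (e x) = e (φ x)` for every `x` in the domain of `φ`. -/
theorem extension_property_for_partial_isometries
    (A : Type u) [MetricSpace A] [Finite A] :
    ∃ (B : Type u) (_ : MetricSpace B) (_ : Finite B) (e : A → B),
      Isometry e ∧
      ∀ (S T : Set A) (φ : S ≃ T),
        (∀ u v : S, dist (φ u : A) (φ v : A) = dist (u : A) (v : A)) →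
        ∃ Φ : B ≃ᵢ B, ∀ u : S, Φ (e u) = e (φ u) := by
  obtain ⟨δ, D, hδ, hδD, hle, hlt⟩ := exists_dist_bounds A
  obtain ⟨N, hN⟩ := exists_nat_ge (D / δ)
  rw [div_le_iff₀ hδ] at hN
  obtain ⟨V, _, w, e, h, hfree⟩ := exists_extendsPartialIsometries_shortcutFree A hδ hδD hle hlt N
  have hfree := h.shortcutFree_of_forall_lt hδ hN hfree
  let := h.pathMetricSpace hδ
  have hdist (x y : V) : dist x y = sInf {l | ∃ k, WeightedWalk w k l x y} := rfl
  refine ⟨V, inferInstance, inferInstance, e, Isometry.of_dist_eq fun x y => ?_,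
    fun S T φ hφ => ?_⟩
  · rw [hdist, ← h.map_dist]
    refine IsLeast.csInf_eq ⟨⟨1, .single w _ _⟩, fun l ⟨k, hl⟩ => hfree k l _ _ hl ?_⟩
    rw [h.map_dist]
    exact hlt x y
  · obtain ⟨θ, hθ, hθe⟩ := h.extend S (fun u => φ u) hφ
    refine ⟨⟨θ, Isometry.of_dist_eq fun x y => ?_⟩, hθe⟩
    rw [hdist, hdist]
    congr 1
    ext l
    refine exists_congr fun k => ⟨fun hl => ?_, .map_perm θ hθ⟩
    have hθ' : ∀ x y, w (θ.symm x) (θ.symm y) = w x y := fun x y => by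
      rw [← hθ, θ.apply_symm_apply, θ.apply_symm_apply]
    simpa using hl.map_perm θ.symm hθ'
end

section
/- Let i ≥ 2 and let G be a finite ℝ>0-edge-labelled graph containing no non-metric cycles on at most i vertices, and containing as an induced subgraph a complete edge-labelled graph A whose labels satisfy the triangle inequality (i.e., A is a finite metric space), such that every partial automorphism of A extends to an automorphism of G. Then there exists a finite ℝ>0-edge-labelled graph G' containing no non-metric cycles on at most i+1 vertices and containing an induced subgraph A' isomorphic to A such that every partial automorphism of A' extends to an automorphism of G'. -/
/-- An `ℝ>0`-edge-labelled graph: an irreflexive symmetric adjacency relation on the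
vertex set together with a symmetric assignment of a positive real label to each edge. -/
structure ELGraph (V : Type*) where
  Adj : V → V → Prop
  label : V → V → ℝ
  adj_symm : ∀ x y, Adj x y → Adj y x
  adj_irrefl : ∀ x, ¬ Adj x x
  label_symm : ∀ x y, label x y = label y x
  label_pos : ∀ x y, Adj x y → 0 < label x y

/-- The cyclic successor of an index in `Fin n`. -/
def Fin.cycSucc {n : ℕ} (i : Fin n) : Fin n := ⟨(i.1 + 1) % n, Nat.mod_lt _ i.pos⟩

namespace ELGraph

variable {V : Type*}

/-- A walk: a nonempty list of vertices with consecutive vertices joined by edges. -/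
def IsWalk (G : ELGraph V) (l : List V) : Prop :=
  l ≠ [] ∧ l.Chain' G.Adj

/-- The length of a walk: the sum of the labels of its (consecutive) edges. -/
def walkLen (G : ELGraph V) (l : List V) : ℝ :=
  ((l.zip l.tail).map fun p => G.label p.1 p.2).sum

/-- A walk connecting `x` and `y`. -/
def IsWalkBetween (G : ELGraph V) (x y : V) (l : List V) : Prop :=
  G.IsWalk l ∧ l.head? = some x ∧ l.getLast? = some y

/-- A path connecting `x` and `y`: a walk with no repeated vertices. -/
def IsPathBetween (G : ELGraph V) (x y : V) (l : List V) : Prop :=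
  G.IsWalkBetween x y l ∧ l.Nodup

/-- `G` is connected: any two vertices are joined by a path. -/
def Connected (G : ELGraph V) : Prop :=
  ∀ x y, ∃ l, G.IsPathBetween x y l

/-- `d` is the shortest-path distance of `G`: `d x x = 0`, and for distinct `x, y`,
`d x y` is the minimum length of a path connecting `x` and `y`. -/
def IsShortestDist (G : ELGraph V) (d : V → V → ℝ) : Prop :=
  (∀ x, d x x = 0) ∧
  ∀ x y, x ≠ y →
    (∃ l, G.IsPathBetween x y l ∧ G.walkLen l = d x y) ∧
    ∀ l, G.IsPathBetween x y l → d x y ≤ G.walkLen l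

/-- A cycle on `n ≥ 3` vertices, given as an injective map `Fin n → V` with consecutive
vertices (cyclically, including the wrap-around pair) joined by edges. -/
def IsCycle (G : ELGraph V) {n : ℕ} (c : Fin n → V) : Prop :=
  3 ≤ n ∧ Function.Injective c ∧ ∀ i, G.Adj (c i) (c i.cycSucc)

/-- The total length of the `n` edges of a cycle. -/
noncomputable def cycleLen (G : ELGraph V) {n : ℕ} (c : Fin n → V) : ℝ :=
  ∑ i, G.label (c i) (c i.cycSucc)

/-- The edge of the cycle at position `i₀` is a long edge: its label is strictly greater
than the sum of the labels of all the remaining edges of the cycle. -/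
def IsLongEdge (G : ELGraph V) {n : ℕ} (c : Fin n → V) (i₀ : Fin n) : Prop :=
  G.cycleLen c - G.label (c i₀) (c i₀.cycSucc) < G.label (c i₀) (c i₀.cycSucc)

/-- A non-metric cycle: a cycle having a long edge. -/
def IsNonMetricCycle (G : ELGraph V) {n : ℕ} (c : Fin n → V) : Prop :=
  G.IsCycle c ∧ ∃ i₀, G.IsLongEdge c i₀

/-- An induced cycle: the only edges of `G` among its vertices are the cycle edges. -/
def IsInducedCycle (G : ELGraph V) {n : ℕ} (c : Fin n → V) : Prop :=
  G.IsCycle c ∧ ∀ i j, G.Adj (c i) (c j) → j = i.cycSucc ∨ i = j.cycSucc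

/-- An embedding of `A` into `B` as an induced subgraph: an injective map on vertices
such that two vertices are joined by an edge of label `ℓ` iff their images are. -/
def IsEmbedding {W : Type*} (A : ELGraph V) (B : ELGraph W) (e : V → W) : Prop :=
  Function.Injective e ∧
  ∀ x y, (A.Adj x y ↔ B.Adj (e x) (e y)) ∧ (A.Adj x y → B.label (e x) (e y) = A.label x y)

/-- An automorphism of `B`: a permutation of the vertices preserving edges, non-edges
and labels. -/
def IsAuto {W : Type*} (B : ELGraph W) (Φ : Equiv.Perm W) : Prop :=
  ∀ x y, (B.Adj x y ↔ B.Adj (Φ x) (Φ y)) ∧ (B.Adj x y → B.label (Φ x) (Φ y) = B.label x y)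

/-- A partial automorphism of `A` with domain `S`: an injective map preserving edges,
non-edges and labels. -/
def IsPartialAuto (A : ELGraph V) (S : Set V) (φ : S → V) : Prop :=
  Function.Injective φ ∧
  ∀ x y : S, (A.Adj x y ↔ A.Adj (φ x) (φ y)) ∧ (A.Adj x y → A.label (φ x) (φ y) = A.label x y)

end ELGraph

universe u

namespace ELGraph

/-- Every edge is at most as long as any walk on at most `n` vertices joining its ends. -/
def EdgesGeodesic {V : Type*} (G : ELGraph V) (n : ℕ) : Prop :=
  ∀ (l : List V) (x y : V), l.length ≤ n → l.IsChain G.Adj → l.head? = some x →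
    l.getLast? = some y → G.Adj x y → G.label x y ≤ G.walkLen l

/-- A walk whose ends are joined by an edge that is strictly longer than the walk. -/
def IsShortcut {V : Type*} (G : ELGraph V) (l : List V) : Prop :=
  l.IsChain G.Adj ∧ ∃ x y, l.head? = some x ∧ l.getLast? = some y ∧ G.Adj x y ∧
    G.walkLen l < G.label x y

/-- `x` and `y` are the two ends of the list `l`, in either order. -/
def IsEnds {V : Type*} (l : List V) (x y : V) : Prop :=
  (l.head? = some x ∧ l.getLast? = some y) ∨ (l.head? = some y ∧ l.getLast? = some x)

section Walks

variable {V : Type*} (G : ELGraph V)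

@[simp] lemma walkLen_nil : G.walkLen [] = 0 := by simp [walkLen]

@[simp] lemma walkLen_singleton (a : V) : G.walkLen [a] = 0 := by simp [walkLen]

@[simp] lemma walkLen_cons_cons (a b : V) (l : List V) :
    G.walkLen (a :: b :: l) = G.label a b + G.walkLen (b :: l) := by simp [walkLen]

lemma walkLen_append (l : List V) (a : V) (l' : List V) :
    G.walkLen (l ++ a :: l') = G.walkLen (l ++ [a]) + G.walkLen (a :: l') := by
  induction l with
  | nil => simp
  | cons b l ih =>
    cases l with
    | nil => simp
    | cons c l => simp only [List.cons_append, walkLen_cons_cons] at ih ⊢; rw [ih, add_assoc]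

lemma walkLen_nonneg {l : List V} (h : l.IsChain G.Adj) : 0 ≤ G.walkLen l := by
  induction l with
  | nil => simp
  | cons a l ih =>
    cases l with
    | nil => simp
    | cons b l =>
      rw [List.isChain_cons_cons] at h
      have := ih h.2
      have := G.label_pos _ _ h.1
      rw [walkLen_cons_cons]; linarith

lemma walkLen_map_range (p : ℕ → V) (m : ℕ) :
    G.walkLen ((List.range (m + 1)).map p) =
      ∑ k ∈ Finset.range m, G.label (p k) (p (k + 1)) := by
  induction m with
  | zero => simp
  | succ m ih =>
    rw [Finset.sum_range_succ, ← ih, List.range_succ, List.range_succ]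
    simp only [List.map_append, List.map_cons, List.map_nil, List.append_assoc,
      List.cons_append, List.nil_append]
    rw [walkLen_append]; simp

lemma walkLen_map {W : Type*} (H : ELGraph W) (f : V → W) {l : List V}
    (hl : l.IsChain fun x y => H.label (f x) (f y) = G.label x y) :
    H.walkLen (l.map f) = G.walkLen l := by
  induction l with
  | nil => simp
  | cons a l ih =>
    cases l with
    | nil => simp
    | cons b l =>
      rw [List.isChain_cons_cons] at hl
      simpa [hl.1] using ih hl.2

variable {G}

lemma isNonMetricCycle_of_isShortcut {p : ℕ → V} {m : ℕ} (hm : 2 ≤ m)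
    (hp : Set.InjOn p (Set.Iic m)) (hl : G.IsShortcut ((List.range (m + 1)).map p)) :
    G.IsNonMetricCycle (fun k : Fin (m + 1) => p k) := by
  obtain ⟨hc, x, y, hx, hy, hxy, hlt⟩ := hl
  rw [walkLen_map_range] at hlt
  obtain rfl : p 0 = x := by simpa [List.range_succ_eq_map] using hx
  obtain rfl : p m = y := by simpa [List.range_succ] using hy
  have hs (k : Fin m) : ((k.castSucc.cycSucc : Fin (m + 1)) : ℕ) = k + 1 := by
    simp only [Fin.cycSucc, Fin.val_castSucc]
    exact Nat.mod_eq_of_lt (by omega)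
  have hlast : (((Fin.last m).cycSucc : Fin (m + 1)) : ℕ) = 0 := by simp [Fin.cycSucc]
  have hadj : ∀ k < m, G.Adj (p k) (p (k + 1)) := by
    intro k hk
    have := List.isChain_iff_getElem.1 hc k (by simpa using hk)
    simpa using this
  refine ⟨⟨by omega, ?_, ?_⟩, Fin.last m, ?_⟩
  · intro a b hab
    exact Fin.ext (hp (Nat.lt_succ_iff.1 a.2) (Nat.lt_succ_iff.1 b.2) hab)
  · intro k
    refine Fin.lastCases ?_ (fun k => ?_) k
    · simpa only [hlast, Fin.val_last] using G.adj_symm _ _ hxy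
    · simpa only [hs, Fin.val_castSucc] using hadj k k.2
  · rw [IsLongEdge, cycleLen, Fin.sum_univ_castSucc]
    simp only [hs, hlast, Fin.val_castSucc, Fin.val_last]
    rw [Fin.sum_univ_eq_sum_range (fun k => G.label (p k) (p (k + 1))), G.label_symm (p m)]
    linarith

lemma exists_shorter_walk {l : List V} (h : ¬ l.Nodup) (hc : l.IsChain G.Adj) :
    ∃ l', l'.length < l.length ∧ l'.IsChain G.Adj ∧ l'.head? = l.head? ∧
      l'.getLast? = l.getLast? ∧ G.walkLen l' ≤ G.walkLen l := by
  induction l with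
  | nil => simp at h
  | cons a l ih =>
    by_cases ha : a ∈ l
    · obtain ⟨s, t, rfl⟩ := List.append_of_mem ha
      have hst : (a :: t).IsChain G.Adj := by
        have : ((a :: s) ++ (a :: t)).IsChain G.Adj := hc
        exact (List.isChain_append.1 this).2.1
      have hs : ((a :: s) ++ [a]).IsChain G.Adj := by
        have : (((a :: s) ++ [a]) ++ t).IsChain G.Adj := by simpa using hc
        exact (List.isChain_append.1 this).1
      refine ⟨a :: t, by simp, hst, by simp, ?_, ?_⟩
      · rw [← List.cons_append, List.getLast?_append_of_ne_nil _ (by simp)]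
      · have := G.walkLen_nonneg hs
        rw [← List.cons_append, walkLen_append]; linarith
    · have hl : ¬ l.Nodup := fun hl => h (List.nodup_cons.2 ⟨ha, hl⟩)
      obtain ⟨l', h1, h2, h3, h4, h5⟩ := ih hl hc.tail
      cases l with
      | nil => simp at hl
      | cons b l =>
        cases l' with
        | nil => simp at h3
        | cons b' l' =>
          obtain rfl : b' = b := by simpa using h3
          rw [List.isChain_cons_cons] at hc
          refine ⟨a :: b' :: l', by simpa using h1, List.isChain_cons_cons.2 ⟨hc.1, h2⟩,
            by simp, by simpa using h4, by simpa using h5⟩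

lemma edgesGeodesic_of_forall_not_isNonMetricCycle {n : ℕ}
    (hG : ∀ (k : ℕ) (c : Fin k → V), k ≤ n → ¬ G.IsNonMetricCycle c) :
    G.EdgesGeodesic n := by
  intro l
  induction hk : l.length using Nat.strong_induction_on generalizing l with
  | _ k ih =>
  subst hk
  intro x y hn hc hx hy hxy
  by_cases hd : l.Nodup
  · by_contra! hlt
    have hne : x ≠ y := fun h => G.adj_irrefl x (h ▸ hxy)
    rcases l with _ | ⟨a, _ | ⟨b, _ | ⟨d, t⟩⟩⟩
    · simp at hx
    · simp only [List.head?_cons, List.getLast?_singleton] at hx hy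
      exact hne (Option.some.inj (hx.symm.trans hy))
    · simp only [List.head?_cons, List.getLast?_cons_cons, List.getLast?_singleton,
        Option.some.injEq] at hx hy
      subst hx hy
      simp at hlt
    · set l := a :: b :: d :: t with hl
      set m := t.length + 2 with hm
      have hlen : l.length = m + 1 := by simp [hl, hm]
      set p : ℕ → V := fun k => l.getD k a with hp
      have hpl : (List.range (m + 1)).map p = l := by
        apply List.ext_getElem
        · simp [hlen]
        · intro k h1 h2
          simp [hp, List.getElem?_eq_getElem h2]
      refine hG (m + 1) (fun k => p k) (hlen ▸ hn)
        (isNonMetricCycle_of_isShortcut (by omega) ?_ ?_)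
      · intro j hj k hk hjk
        have hj : j < l.length := by rw [hlen]; exact Nat.lt_succ_iff.2 hj
        have hk : k < l.length := by rw [hlen]; exact Nat.lt_succ_iff.2 hk
        simp only [hp, List.getD_eq_getElem _ _ hj, List.getD_eq_getElem _ _ hk] at hjk
        exact (hd.getElem_inj_iff).1 hjk
      · rw [hpl]; exact ⟨hc, x, y, hx, hy, hxy, hlt⟩
  · obtain ⟨l', h1, h2, h3, h4, h5⟩ := exists_shorter_walk hd hc
    exact (ih _ h1 l' rfl x y (h1.le.trans hn) h2 (h3.trans hx) (h4.trans hy) hxy).trans h5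

lemma EdgesGeodesic.not_isNonMetricCycle {n : ℕ} (hG : G.EdgesGeodesic n)
    {k : ℕ} (c : Fin k → V) (hk : k ≤ n) : ¬ G.IsNonMetricCycle c := by
  rintro ⟨⟨h3, -, hadj⟩, i₀, hlong⟩
  obtain ⟨m, rfl⟩ : ∃ m, k = m + 1 := ⟨k - 1, by omega⟩
  set q : ℕ → Fin (m + 1) := fun k => Fin.ofNat (m + 1) (k + (i₀ + 1)) with hq
  set p : ℕ → V := fun k => c (q k) with hp
  have hp1 (k : ℕ) : p (k + 1) = c (q k).cycSucc := by
    simp only [hp]; congr 1; ext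
    simp [hq, Fin.cycSucc, add_right_comm]
  have hp0 : p 0 = c i₀.cycSucc := by
    simp only [hp]; congr 1; ext
    simp [hq, Fin.cycSucc]
  have hqm : q m = i₀ := by
    ext
    have : m + (i₀ + 1) = i₀ + (m + 1) := by omega
    simp only [hq, Fin.val_ofNat, this, Nat.add_mod_right]
    exact Nat.mod_eq_of_lt i₀.2
  have hpm : p m = c i₀ := by simp only [hp, hqm]
  have hend : G.label (p m) (p (m + 1)) = G.label (c i₀) (c i₀.cycSucc) := by
    rw [hpm, hp1, hqm]
  have hsum : G.cycleLen c = ∑ k ∈ Finset.range (m + 1), G.label (p k) (p (k + 1)) := by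
    have h (k : Fin (m + 1)) : k + (i₀ + 1) = q k := by
      ext; simp [hq, Fin.val_add]
    rw [cycleLen, ← Equiv.sum_comp (Equiv.addRight (i₀ + 1)),
      ← Fin.sum_univ_eq_sum_range (fun k => G.label (p k) (p (k + 1)))]
    refine Finset.sum_congr rfl fun k _ => ?_
    rw [hp1, Equiv.coe_addRight]
    simp only [h, hp]
  have := hG ((List.range (m + 1)).map p) (c i₀.cycSucc) (c i₀) (by simpa using hk)
    (List.isChain_iff_getElem.2 fun k _ => by simpa [hp1] using hadj _)
    (by simp [List.range_succ_eq_map, hp0]) (by simp [List.range_succ, hpm])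
    (G.adj_symm _ _ (hadj i₀))
  rw [walkLen_map_range, G.label_symm] at this
  rw [IsLongEdge, hsum, Finset.sum_range_succ, hend] at hlong
  linarith

end Walks

section Cover

variable {V : Type*}

lemma IsEnds.symm {l : List V} {x y : V} (h : IsEnds l x y) : IsEnds l y x := Or.symm h

lemma isEnds_comm {l : List V} {x y : V} : IsEnds l x y ↔ IsEnds l y x :=
  ⟨IsEnds.symm, IsEnds.symm⟩

/-- The cover of `G` whose vertices carry a two-valued valuation of the vertex lists of
length `n`. Its edges lie over the edges of `G`, and across an edge inside a shortcut of
length `n` the valuation changes exactly when the edge joins the ends of the shortcut. -/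
def cover (G : ELGraph V) (n : ℕ) : ELGraph (V × (List.Vector V n → Bool)) where
  Adj u v := G.Adj u.1 v.1 ∧ ∀ C : List.Vector V n, G.IsShortcut C.toList →
    u.1 ∈ C.toList → v.1 ∈ C.toList → (u.2 C ≠ v.2 C ↔ IsEnds C.toList u.1 v.1)
  label u v := G.label u.1 v.1
  adj_symm u v h := ⟨G.adj_symm _ _ h.1, fun C hC hv hu => by
    rw [ne_comm, isEnds_comm]; exact h.2 C hC hu hv⟩
  adj_irrefl u h := G.adj_irrefl _ h.1
  label_symm u v := G.label_symm _ _
  label_pos u v h := G.label_pos _ _ h.1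

variable {G : ELGraph V} {n : ℕ}

lemma EdgesGeodesic.nodup_of_isShortcut (hG : G.EdgesGeodesic n) {l : List V}
    (hn : l.length ≤ n + 1) (hl : G.IsShortcut l) : l.Nodup := by
  by_contra h
  obtain ⟨hc, x, y, hx, hy, hxy, hlt⟩ := hl
  obtain ⟨l', h1, h2, h3, h4, h5⟩ := exists_shorter_walk h hc
  have := hG l' x y (by omega) h2 (h3.trans hx) (h4.trans hy) hxy
  linarith

lemma EdgesGeodesic.cover (hG : G.EdgesGeodesic n) (hn : 2 ≤ n) :
    (G.cover (n + 1)).EdgesGeodesic (n + 1) := by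
  intro l x y hln hc hx hy hxy
  by_contra! hlt
  have hc' : (l.map Prod.fst).IsChain G.Adj :=
    List.isChain_map _ |>.2 (hc.imp fun u v h => h.1)
  have hx' : (l.map Prod.fst).head? = some x.1 := by simp [hx]
  have hy' : (l.map Prod.fst).getLast? = some y.1 := by simp [hy]
  have hlt' : G.walkLen (l.map Prod.fst) < G.label x.1 y.1 := by
    rwa [walkLen_map (G.cover (n + 1)) G Prod.fst (hc.imp fun u v h => rfl)]
  have hlen : l.length = n + 1 := by
    by_contra hne
    exact absurd (hG _ _ _ (by rw [List.length_map]; omega) hc' hx' hy' hxy.1) (not_le.2 hlt')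
  have hs : G.IsShortcut (l.map Prod.fst) := ⟨hc', _, _, hx', hy', hxy.1, hlt'⟩
  have hd := hG.nodup_of_isShortcut (by simp [hlen]) hs
  set C : List.Vector V (n + 1) := ⟨l.map Prod.fst, by simp [hlen]⟩ with hC
  have hmem {u} (hu : u ∈ l) : u.1 ∈ C.toList := List.mem_map_of_mem hu
  have hx0 : x = l[0] := by
    rw [List.head?_eq_getElem?, List.getElem?_eq_getElem (by omega)] at hx
    exact (Option.some.inj hx).symm
  have hyn : y = l[n] := by
    rw [List.getLast?_eq_getElem?, List.getElem?_eq_getElem (by omega)] at hy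
    simpa [hlen] using (Option.some.inj hy).symm
  have hinj {j k : ℕ} (hj : j < l.length) (hk : k < l.length) (h : l[j].1 = l[k].1) :
      j = k := by
    refine (hd.getElem_inj_iff (hi := by simpa using hj) (hj := by simpa using hk)).1 ?_
    simpa using h
  have hconst (k : ℕ) (hk : k < l.length) : l[k].2 C = x.2 C := by
    induction k with
    | zero => rw [hx0]
    | succ k ih =>
      rw [← ih (by omega)]
      by_contra hne
      have := ((List.isChain_iff_getElem.1 hc k hk).2 C hs (hmem (List.getElem_mem _))
        (hmem (List.getElem_mem _))).1 (Ne.symm hne)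
      rcases this with ⟨h1, h2⟩ | ⟨h1, h2⟩
      · have h1 := hinj (by omega) (by omega)
          ((congrArg Prod.fst hx0).symm.trans (Option.some.inj (hx'.symm.trans h1)))
        have h2 := hinj (by omega) (by omega)
          ((congrArg Prod.fst hyn).symm.trans (Option.some.inj (hy'.symm.trans h2)))
        omega
      · have h2 := hinj (by omega) (by omega)
          ((congrArg Prod.fst hyn).symm.trans (Option.some.inj (hy'.symm.trans h2)))
        omega
  refine (hxy.2 C hs (hmem (List.mem_of_mem_head? hx))
    (hmem (List.mem_of_mem_getLast? hy))).2 (Or.inl ⟨hx', hy'⟩) ?_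
  subst hyn
  exact (hconst n (by omega)).symm

open Classical in
/-- The permutation of the vertices of a cover that lies over `Φ` and flips the valuations
of the lists selected by `F` at the vertices of these lists. -/
noncomputable def coverPerm (Φ : Equiv.Perm V) (F : List.Vector V n → Bool) :
    Equiv.Perm (V × (List.Vector V n → Bool)) where
  toFun u := (Φ u.1, fun C => xor (u.2 (C.map Φ.symm))
    (F (C.map Φ.symm) && decide (u.1 ∈ (C.map Φ.symm).toList)))
  invFun u := (Φ.symm u.1, fun C => xor (u.2 (C.map Φ))
    (F C && decide (Φ.symm u.1 ∈ C.toList)))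
  left_inv u := by
    have h (C : List.Vector V n) : (C.map Φ).map Φ.symm = C := by
      apply List.Vector.toList_injective; simp
    ext <;> simp [h]
  right_inv u := by
    have h (C : List.Vector V n) : (C.map Φ.symm).map Φ = C := by
      apply List.Vector.toList_injective; simp
    ext <;> simp [h]

@[simp] lemma coverPerm_fst (Φ : Equiv.Perm V) (F : List.Vector V n → Bool)
    (u : V × (List.Vector V n → Bool)) : (coverPerm Φ F u).1 = Φ u.1 := rfl

open Classical in
lemma coverPerm_snd_map (Φ : Equiv.Perm V) (F : List.Vector V n → Bool)
    (u : V × (List.Vector V n → Bool)) (C : List.Vector V n) :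
    (coverPerm Φ F u).2 (C.map Φ) = xor (u.2 C) (F C && decide (u.1 ∈ C.toList)) := by
  have h : (C.map Φ).map Φ.symm = C := by
    apply List.Vector.toList_injective; simp
  simp [coverPerm, h]

lemma exists_vector_map_eq (Φ : Equiv.Perm V) (C : List.Vector V n) :
    ∃ D : List.Vector V n, C = D.map Φ :=
  ⟨C.map Φ.symm, by apply List.Vector.toList_injective; simp⟩

lemma isEnds_map_iff {W : Type*} {f : V → W} (hf : Function.Injective f) {l : List V}
    {x y : V} : IsEnds (l.map f) (f x) (f y) ↔ IsEnds l x y := by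
  simp [IsEnds, hf.eq_iff]

lemma IsAuto.isShortcut_map_iff {Φ : Equiv.Perm V} (hΦ : G.IsAuto Φ) {l : List V} :
    G.IsShortcut (l.map Φ) ↔ G.IsShortcut l := by
  have hc : (l.map Φ).IsChain G.Adj ↔ l.IsChain G.Adj := by
    rw [List.isChain_map]
    exact ⟨fun h => h.imp fun x y => (hΦ x y).1.2, fun h => h.imp fun x y => (hΦ x y).1.1⟩
  rw [IsShortcut, IsShortcut, hc]
  refine and_congr_right fun h => ?_
  rw [walkLen_map G G Φ (h.imp fun x y hxy => (hΦ x y).2 hxy)]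
  constructor
  · rintro ⟨x, y, hx, hy, hxy, hlt⟩
    obtain ⟨x, rfl⟩ := Φ.surjective x
    obtain ⟨y, rfl⟩ := Φ.surjective y
    have hxy := (hΦ x y).1.2 hxy
    exact ⟨x, y, by simpa using hx, by simpa using hy, hxy, (hΦ x y).2 hxy ▸ hlt⟩
  · rintro ⟨x, y, hx, hy, hxy, hlt⟩
    exact ⟨Φ x, Φ y, by simp [hx], by simp [hy], (hΦ x y).1.1 hxy,
      ((hΦ x y).2 hxy).symm ▸ hlt⟩

lemma IsAuto.coverPerm {Φ : Equiv.Perm V} (hΦ : G.IsAuto Φ) (F : List.Vector V n → Bool) :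
    (G.cover n).IsAuto (coverPerm Φ F) := by
  intro u v
  refine ⟨and_congr (hΦ _ _).1 ?_, fun h => (hΦ _ _).2 h.1⟩
  have key (C : List.Vector V n) (hu : u.1 ∈ C.toList) (hv : v.1 ∈ C.toList) :
      (ELGraph.coverPerm Φ F u).2 (C.map Φ) ≠ (ELGraph.coverPerm Φ F v).2 (C.map Φ) ↔
        u.2 C ≠ v.2 C := by
    simp [coverPerm_snd_map, hu, hv]
  constructor
  · intro h C hC hu hv
    obtain ⟨C, rfl⟩ := exists_vector_map_eq Φ C
    rw [List.Vector.toList_map] at hC hu hv ⊢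
    have hu : u.1 ∈ C.toList := by simpa using hu
    have hv : v.1 ∈ C.toList := by simpa using hv
    rw [key C hu hv, coverPerm_fst, coverPerm_fst, isEnds_map_iff Φ.injective]
    exact h C (hΦ.isShortcut_map_iff.1 hC) hu hv
  · intro h C hC hu hv
    have := h (C.map Φ)
    rw [List.Vector.toList_map, key C hu hv, coverPerm_fst, coverPerm_fst,
      isEnds_map_iff Φ.injective] at this
    exact this (hΦ.isShortcut_map_iff.2 hC) (List.mem_map_of_mem hu) (List.mem_map_of_mem hv)

open Classical in
/-- The lift of an embedding `e` to a cover: a shortcut is given the value `true` exactly at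
its first vertex, and only if its last vertex is also in the image of `e`. -/
noncomputable def coverLift {VA : Type*} (G : ELGraph V) (e : VA → V) (n : ℕ) (a : VA) :
    V × (List.Vector V n → Bool) :=
  (e a, fun C => decide (G.IsShortcut C.toList ∧ C.toList.head? = some (e a) ∧
    ∃ b, C.toList.getLast? = some (e b)))

section Lift

variable {VA : Type*} {A : ELGraph VA} {e : VA → V}

lemma IsEmbedding.getLast?_of_isShortcut (he : A.IsEmbedding G e) (hG : G.EdgesGeodesic n)
    (hAcomp : ∀ x y : VA, x ≠ y → A.Adj x y)
    (hAmetric : ∀ x y z : VA, x ≠ y → y ≠ z → x ≠ z →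
      A.label x z ≤ A.label x y + A.label y z)
    {l : List V} (hn : l.length ≤ n + 1) (hl : G.IsShortcut l) {a b d : VA}
    (ha : l.head? = some (e a)) (hd : l.getLast? = some (e d)) (hb : e b ∈ l)
    (hab : a ≠ b) : l.getLast? = some (e b) := by
  by_cases hbd : b = d
  · rwa [hbd]
  exfalso
  obtain ⟨hc, x, y, hx, hy, hxy, hlt⟩ := hl
  obtain rfl : e a = x := Option.some.inj (ha.symm.trans hx)
  obtain rfl : e d = y := Option.some.inj (hd.symm.trans hy)
  have had : a ≠ d := by rintro rfl; exact G.adj_irrefl _ hxy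
  obtain ⟨s, t, rfl⟩ := List.append_of_mem hb
  have hs : s ≠ [] := by
    rintro rfl
    exact hab (he.1 (by simpa using ha)).symm
  have ht : t ≠ [] := by
    rintro rfl
    exact hbd (he.1 (by simpa using hd))
  have hs0 := List.length_pos_iff.2 hs
  have ht0 := List.length_pos_iff.2 ht
  rw [List.length_append, List.length_cons] at hn
  have hlab {x y : VA} (h : x ≠ y) : G.Adj (e x) (e y) ∧ G.label (e x) (e y) = A.label x y :=
    ⟨(he.2 x y).1.1 (hAcomp x y h), (he.2 x y).2 (hAcomp x y h)⟩
  have h1 := hG (s ++ [e b]) (e a) (e b) (by simp; omega)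
    ((List.isChain_append.1 (show ((s ++ [e b]) ++ t).IsChain G.Adj by simpa using hc)).1)
    (by rw [List.head?_append_of_ne_nil _ hs] at ha ⊢; exact ha) (by simp) (hlab hab).1
  have h2 := hG (e b :: t) (e b) (e d) (by simp; omega) (List.isChain_append.1 hc).2.1
    (by simp) (by rwa [List.getLast?_append_of_ne_nil _ (by simp)] at hd) (hlab hbd).1
  rw [walkLen_append] at hlt
  have := hAmetric a b d hab hbd had
  rw [(hlab hab).2] at h1
  rw [(hlab hbd).2] at h2
  rw [(hlab had).2] at hlt
  linarith

lemma IsEmbedding.coverLift (he : A.IsEmbedding G e) (hG : G.EdgesGeodesic n)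
    (hAcomp : ∀ x y : VA, x ≠ y → A.Adj x y)
    (hAmetric : ∀ x y z : VA, x ≠ y → y ≠ z → x ≠ z →
      A.label x z ≤ A.label x y + A.label y z) :
    A.IsEmbedding (G.cover (n + 1)) (G.coverLift e (n + 1)) := by
  refine ⟨fun a b h => he.1 (congrArg Prod.fst h), fun a b =>
    ⟨⟨fun h => ⟨(he.2 a b).1.1 h, fun C hC ha hb => ?_⟩, fun h => (he.2 a b).1.2 h.1⟩,
      (he.2 a b).2⟩⟩
  have hab : a ≠ b := by rintro rfl; exact A.adj_irrefl _ h
  have hlen : C.toList.length ≤ n + 1 := by simp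
  have hlast {a b d : VA} := he.getLast?_of_isShortcut hG hAcomp hAmetric hlen hC
    (a := a) (b := b) (d := d)
  have hval (x : VA) : (G.coverLift e (n + 1) x).2 C = true ↔
      C.toList.head? = some (e x) ∧ ∃ d, C.toList.getLast? = some (e d) := by
    simp [ELGraph.coverLift, hC]
  rw [Ne, Bool.eq_iff_iff, hval, hval]
  constructor
  · intro hne
    by_cases h1 : C.toList.head? = some (e a) ∧ ∃ d, C.toList.getLast? = some (e d)
    · obtain ⟨h1, d, hd⟩ := h1
      exact Or.inl ⟨h1, hlast h1 hd hb hab⟩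
    · have h2 : C.toList.head? = some (e b) ∧ ∃ d, C.toList.getLast? = some (e d) := by
        tauto
      obtain ⟨h2, d, hd⟩ := h2
      exact Or.inr ⟨h2, hlast h2 hd ha hab.symm⟩
  · rintro (⟨h1, h2⟩ | ⟨h1, h2⟩) hiff
    · exact hab (he.1 (Option.some.inj (h1.symm.trans (hiff.1 ⟨h1, b, h2⟩).1)))
    · exact hab (he.1 (Option.some.inj ((hiff.2 ⟨h1, a, h2⟩).1.symm.trans h1)))

lemma IsPartialAuto.exists_extension_cover {S : Set VA} {φ : S → VA}
    (hφ : A.IsPartialAuto S φ) (hAcomp : ∀ x y : VA, x ≠ y → A.Adj x y)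
    (he : A.IsEmbedding (G.cover n) (G.coverLift e n)) {Φ : Equiv.Perm V} (hΦ : G.IsAuto Φ)
    (hΦe : ∀ x : S, Φ (e x) = e (φ x)) :
    ∃ Ψ : Equiv.Perm (V × (List.Vector V n → Bool)), (G.cover n).IsAuto Ψ ∧
      ∀ x : S, Ψ (G.coverLift e n x) = G.coverLift e n (φ x) := by
  classical
  let F : List.Vector V n → Bool := fun C => decide (∃ x : S, e x ∈ C.toList ∧
    (G.coverLift e n x).2 C ≠ (G.coverLift e n (φ x)).2 (C.map Φ))
  refine ⟨coverPerm Φ F, hΦ.coverPerm F, fun x => Prod.ext (hΦe x) (funext fun C => ?_)⟩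
  obtain ⟨C, rfl⟩ := exists_vector_map_eq Φ C
  rw [coverPerm_snd_map]
  by_cases hC : G.IsShortcut C.toList
  swap
  · have hC' : ¬ G.IsShortcut (C.toList.map Φ) := by rwa [hΦ.isShortcut_map_iff]
    simp [F, coverLift, hC, hC']
  have hfst : (G.coverLift e n x).1 = e x := rfl
  by_cases hx : e x ∈ C.toList
  swap
  · have h1 : C.toList.head? ≠ some (e x) := fun h => hx (List.mem_of_mem_head? h)
    simp [coverLift, hx, h1, ← hΦe x]
  have hval (y : S) (hy : e y ∈ C.toList) :
      ((G.coverLift e n x).2 C ≠ (G.coverLift e n y).2 C ↔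
        (G.coverLift e n (φ x)).2 (C.map Φ) ≠ (G.coverLift e n (φ y)).2 (C.map Φ)) := by
    by_cases hxy : x = y
    · simp [hxy]
    have h1 := ((he.2 x y).1.1 (hAcomp _ _ fun h => hxy (Subtype.ext h))).2 C hC hx hy
    have h2 := ((he.2 (φ x) (φ y)).1.1 (hAcomp _ _ fun h => hxy (hφ.1 h))).2 (C.map Φ)
    simp only [coverLift, List.Vector.toList_map, ← hΦe, isEnds_map_iff Φ.injective] at h1 h2 ⊢
    exact h1.trans (h2 (hΦ.isShortcut_map_iff.2 hC) (List.mem_map_of_mem hx)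
      (List.mem_map_of_mem hy)).symm
  have hF : F C = true ↔
      (G.coverLift e n x).2 C ≠ (G.coverLift e n (φ x)).2 (C.map Φ) := by
    rw [decide_eq_true_iff]
    refine ⟨fun ⟨y, hy, hne⟩ => ?_, fun h => ⟨x, hx, h⟩⟩
    have h : ∀ a b c d : Bool, (a ≠ b ↔ c ≠ d) → b ≠ d → a ≠ c := by decide
    exact h _ _ _ _ (hval y hy) hne
  have h : ∀ a c f : Bool, (f = true ↔ a ≠ c) → xor a f = c := by decide
  rw [hfst, decide_eq_true hx, Bool.and_true]
  exact h _ _ _ hF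

end Lift

end Cover

end ELGraph

/-- The inductive step: let `i ≥ 2` and let `G` be a finite `ℝ>0`-edge-labelled graph
with no non-metric cycles on at most `i` vertices, containing as an induced subgraph a
complete edge-labelled graph `A` satisfying the triangle inequality (a finite metric
space), such that every partial automorphism of `A` extends to an automorphism of `G`.
Then there is a finite `ℝ>0`-edge-labelled graph `G'` with no non-metric cycles on at
most `i + 1` vertices, containing an induced copy `A'` of `A` such that every partial
automorphism of `A'` extends to an automorphism of `G'`. -/
theorem eliminate_nonmetric_cycles_step {V : Type u} [Fintype V] (i : ℕ) (hi : 2 ≤ i)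
    (G : ELGraph V)
    (hG : ∀ (n : ℕ) (c : Fin n → V), n ≤ i → ¬ G.IsNonMetricCycle c)
    {VA : Type u} [Fintype VA] (A : ELGraph VA)
    (hAcomp : ∀ x y : VA, x ≠ y → A.Adj x y)
    (hAmetric : ∀ x y z : VA, x ≠ y → y ≠ z → x ≠ z →
      A.label x z ≤ A.label x y + A.label y z)
    (e : VA → V) (he : A.IsEmbedding G e)
    (hEPPA : ∀ (S : Set VA) (φ : S → VA), A.IsPartialAuto S φ →
      ∃ Φ : Equiv.Perm V, G.IsAuto Φ ∧ ∀ x : S, Φ (e x) = e (φ x)) :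
    ∃ (W : Type u) (_ : Fintype W) (G' : ELGraph W) (e' : VA → W),
      (∀ (n : ℕ) (c : Fin n → W), n ≤ i + 1 → ¬ G'.IsNonMetricCycle c) ∧
      A.IsEmbedding G' e' ∧
      ∀ (S : Set VA) (φ : S → VA), A.IsPartialAuto S φ →
        ∃ Φ : Equiv.Perm W, G'.IsAuto Φ ∧ ∀ x : S, Φ (e' x) = e' (φ x) := by
  have hG' := ELGraph.edgesGeodesic_of_forall_not_isNonMetricCycle hG
  have hlift := he.coverLift hG' hAcomp hAmetric
  refine ⟨V × (List.Vector V (i + 1) → Bool), Fintype.ofFinite _, G.cover (i + 1),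
    G.coverLift e (i + 1), fun n c hn => (hG'.cover hi).not_isNonMetricCycle c hn, hlift,
    fun S φ hφ => ?_⟩
  obtain ⟨Φ, hΦ, hΦe⟩ := hEPPA S φ hφ
  exact hφ.exists_extension_cover hAcomp hlift hΦ hΦe
end
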